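/- arXiv:2312.09643 — 4 statements merged into one kernel-verified Lean document; each statement's English description precedes it below -/
import Mathlib

section
/- Let G be a finite group, let D, d1, d2 be positive integers, and let ω : G → M_D(ℂ), τ1 : G → M_{d1}(ℂ), τ2 : G → M_{d2}(ℂ) be matrix representations (i.e., multiplicative maps sending the identity of G to the identity matrix). Let Λ_L, Λ_R ∈ M_D(ℂ) and set Λ = Λ_R·Λ_L. Let X be a finite set; for each x ∈ X fix a row vector ℓ_x ∈ ℂ^D, fix a column vector ρ ∈ ℂ^D, for each (x,y) ∈ X×X fix a matrix B_{xy} ∈ M_{d1·d2}(ℂ) (acting on ℂ^{d1}⊗ℂ^{d2}), and fix A ∈ M_{d1·d2}(ℂ). For m ≥ 1 and a sequence g⃗ = (g_1,…,g_m) ∈ G^m define the scalar p(x,g⃗) = ℓ_x·(Λ_L ω(g_m) Λ_R)·(Λ_L ω(g_{m−1}) Λ_R)⋯(Λ_L ω(g_1) Λ_R)·ρ, and for two sequences g⃗¹, g⃗² ∈ G^m define f_A(x,y,g⃗¹,g⃗²) = Tr( B_{xy}·(τ1(g¹_m)⊗τ2(g²_m))·[A·(τ1(g¹_{m−1})⊗τ2(g²_{m−1}))]·[A·(τ1(g¹_{m−2})⊗τ2(g²_{m−2}))]⋯[A·(τ1(g¹_1)⊗τ2(g²_1))]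 ) (the bracketed factors in decreasing order of the index i = m−1,…,1; for m = 1 this product is empty). Define k_A(m) = |G|^{−2m} Σ_{g⃗¹,g⃗² ∈ G^m} Σ_{x,y ∈ X} f_A(x,y,g⃗¹,g⃗²)·p(x,g⃗¹)·p(y,g⃗²). On ℂ^{d1}⊗ℂ^{d2}⊗ℂ^D⊗ℂ^D define P = |G|^{−2} Σ_{g,h ∈ G} τ1(g)⊗τ2(h)⊗ω(g)⊗ω(h), Θ = P·( Σ_{x,y∈X} B_{xy} ⊗ (v·r_x) ⊗ (v·r_y) )·P where v = Λ_R·ρ is a column vector, r_x = ℓ_x·Λ_L is a row vector, and v·r_x is the D×D rank-one matrix, and Φ = P·(A ⊗ Λ ⊗ Λ)·P (A acting on the factor ℂ^{d1}⊗ℂ^{d2}, the two copies of Λ on the two factors ℂ^D). Then for every m ≥ 1, k_A(m) = Tr(Θ·Φ^{m−1}). -/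
open Matrix Kronecker BigOperators

theorem aux_sum {G R : Type} [Fintype G] [Semiring R] (F : G → G → R) (m : ℕ) :
    ∑ g1 : Fin m → G, ∑ g2 : Fin m → G,
      (List.ofFn fun i : Fin m => F (g1 i) (g2 i)).reverse.prod = (∑ g : G, ∑ h : G, F g h) ^ m := by
  induction m with
  | zero => simp
  | succ n ih =>
    rw [← (Fin.consEquiv (fun _ : Fin (n + 1) => G)).sum_comp, Fintype.sum_prod_type]
    simp_rw [fun f : (Fin (n + 1) → G) → R =>
      ((Fin.consEquiv (fun _ : Fin (n + 1) => G)).sum_comp f).symm, Fintype.sum_prod_type]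
    simp only [Fin.consEquiv, Equiv.coe_fn_mk, List.ofFn_succ, Fin.cons_zero, Fin.cons_succ,
      List.reverse_cons, List.prod_append, List.prod_singleton]
    rw [pow_succ, ← ih]
    simp only [Finset.mul_sum, Finset.sum_mul]
    refine Finset.sum_congr rfl fun a _ => ?_
    rw [Finset.sum_comm]

theorem aux_snoc {G R : Type} [Fintype G] [Semiring R] (F : G → G → R)
    (K : G → G → R) (m : ℕ) :
    ∑ g1 : Fin (m + 1) → G, ∑ g2 : Fin (m + 1) → G,
      K (g1 (Fin.last m)) (g2 (Fin.last m)) *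
      (List.ofFn fun i : Fin m => F (g1 i.castSucc) (g2 i.castSucc)).reverse.prod
      = (∑ g : G, ∑ h : G, K g h) * (∑ g : G, ∑ h : G, F g h) ^ m := by
  rw [← (Fin.snocEquiv (fun _ : Fin (m + 1) => G)).sum_comp, Fintype.sum_prod_type]
  simp_rw [fun f : (Fin (m + 1) → G) → R =>
    ((Fin.snocEquiv (fun _ : Fin (m + 1) => G)).sum_comp f).symm, Fintype.sum_prod_type]
  simp only [Fin.snocEquiv, Equiv.coe_fn_mk, Fin.snoc_last, Fin.snoc_castSucc]
  rw [← aux_sum]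
  conv_lhs =>
    enter [2, a]
    rw [Finset.sum_comm]
  simp only [← Finset.mul_sum, ← Finset.sum_mul]

theorem aux_shift {R : Type} [Monoid R] (L Q : R) (m : ℕ) (w : Fin m → R) :
    Q * (List.ofFn fun i : Fin m => L * w i * Q).reverse.prod =
      (List.ofFn fun i : Fin m => Q * L * w i).reverse.prod * Q := by
  induction m with
  | zero => simp
  | succ n ih =>
    simp only [List.ofFn_succ, List.reverse_cons, List.prod_append, List.prod_singleton]
    rw [← mul_assoc, ih]
    simp only [mul_assoc]

theorem aux_kron {a b : Type} [Fintype a] [Fintype b] [DecidableEq a] [DecidableEq b] (m : ℕ)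
    (u : Fin m → Matrix a a ℂ) (v : Fin m → Matrix b b ℂ) :
    (List.ofFn fun i => u i ⊗ₖ v i).reverse.prod =
      (List.ofFn u).reverse.prod ⊗ₖ (List.ofFn v).reverse.prod := by
  induction m with
  | zero => simp
  | succ n ih =>
    simp only [List.ofFn_succ, List.reverse_cons, List.prod_append, List.prod_singleton]
    rw [ih, ← Matrix.mul_kronecker_mul]

theorem aux_proj {R : Type} [Monoid R] (P M : R) (hP : P * P = P) (m : ℕ) :
    P * (P * M * P) ^ m = P * (M * P) ^ m ∧ P * (M * P) ^ m * P = P * (M * P) ^ m := by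
  have h2 : P * (M * P) ^ m * P = P * (M * P) ^ m := by
    cases m with
    | zero => simp [hP]
    | succ n => rw [pow_succ]; simp only [mul_assoc, hP]
  refine ⟨?_, h2⟩
  clear h2
  induction m with
  | zero => simp
  | succ n ih =>
    rw [pow_succ, ← mul_assoc, ih, pow_succ]
    have h2 : P * (M * P) ^ n * P = P * (M * P) ^ n := by
      cases n with
      | zero => simp [hP]
      | succ n => rw [pow_succ]; simp only [mul_assoc, hP]
    calc _ = (P * (M * P) ^ n * P) * (M * P) := by simp only [mul_assoc]
      _ = _ := by rw [h2, mul_assoc]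

theorem aux_p {d : Type} [Fintype d] [DecidableEq d] (L Q W : Matrix d d ℂ) (l r : d → ℂ)
    (m : ℕ) (w : Fin m → Matrix d d ℂ) :
    l ⬝ᵥ ((L * W * Q) * (List.ofFn fun i : Fin m => L * w i * Q).reverse.prod).mulVec r =
      Matrix.trace (vecMulVec (Q.mulVec r) (l ᵥ* L) *
        (W * (List.ofFn fun i : Fin m => Q * L * w i).reverse.prod)) := by
  rw [mul_assoc (L * W), aux_shift]
  rw [vecMulVec_mul, trace_vecMulVec, dotProduct_comm (Q *ᵥ r), ← dotProduct_mulVec, ← dotProduct_mulVec]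
  simp only [mulVec_mulVec, mul_assoc]

/-- Theorem 1 of the paper (generalized UIRS protocol with two independently sampled
gate sequences): the second-order correlator `k_A(m)` equals `Tr(Θ · Φ^{m-1})`.
Sequence length `m ≥ 1` is represented as `m + 1` for `m : ℕ`, and a sequence
`(g_1, …, g_{m+1})` is a function `Fin (m+1) → G` (index `i` corresponding to `g_{i+1}`).
Ordered products `M_m ⋯ M_1` are expressed as `(List.ofFn f).reverse.prod`. -/
theorem statement0
    (G : Type) [Fintype G] [Group G]
    (D d1 d2 : ℕ) (hD : 0 < D) (hd1 : 0 < d1) (hd2 : 0 < d2)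
    (ω : G → Matrix (Fin D) (Fin D) ℂ)
    (τ1 : G → Matrix (Fin d1) (Fin d1) ℂ)
    (τ2 : G → Matrix (Fin d2) (Fin d2) ℂ)
    (hω1 : ω 1 = 1) (hω : ∀ g h : G, ω (g * h) = ω g * ω h)
    (hτ11 : τ1 1 = 1) (hτ1 : ∀ g h : G, τ1 (g * h) = τ1 g * τ1 h)
    (hτ21 : τ2 1 = 1) (hτ2 : ∀ g h : G, τ2 (g * h) = τ2 g * τ2 h)
    (ΛL ΛR Λ : Matrix (Fin D) (Fin D) ℂ) (hΛ : Λ = ΛR * ΛL)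
    (X : Type) [Fintype X]
    (ℓ : X → Fin D → ℂ) (ρ : Fin D → ℂ)
    (B : X → X → Matrix (Fin d1 × Fin d2) (Fin d1 × Fin d2) ℂ)
    (A : Matrix (Fin d1 × Fin d2) (Fin d1 × Fin d2) ℂ)
    -- the outcome probability p(x, g⃗) = ℓ_x (Λ_L ω(g_m) Λ_R) ⋯ (Λ_L ω(g_1) Λ_R) ρ
    (p : X → (m : ℕ) → (Fin m → G) → ℂ)
    (hp : ∀ (x : X) (m : ℕ) (g : Fin m → G),
      p x m g = ℓ x ⬝ᵥ ((List.ofFn fun i : Fin m => ΛL * ω (g i) * ΛR).reverse.prod).mulVec ρ)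
    -- the second-order sequence correlation function f_A(x, y, g⃗¹, g⃗²)
    (fA : X → X → (m : ℕ) → (Fin (m + 1) → G) → (Fin (m + 1) → G) → ℂ)
    (hfA : ∀ (x y : X) (m : ℕ) (g1 g2 : Fin (m + 1) → G),
      fA x y m g1 g2 =
        Matrix.trace (B x y * (τ1 (g1 (Fin.last m)) ⊗ₖ τ2 (g2 (Fin.last m))) *
          (List.ofFn fun i : Fin m =>
            A * (τ1 (g1 i.castSucc) ⊗ₖ τ2 (g2 i.castSucc))).reverse.prod))
    -- the correlator k_A at sequence length m + 1
    (kA : ℕ → ℂ)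
    (hkA : ∀ m : ℕ,
      kA m = ((Fintype.card G : ℂ) ^ (2 * (m + 1)))⁻¹ *
        ∑ g1 : Fin (m + 1) → G, ∑ g2 : Fin (m + 1) → G, ∑ x : X, ∑ y : X,
          fA x y m g1 g2 * p x (m + 1) g1 * p y (m + 1) g2)
    -- the group-averaged projector P
    (P : Matrix ((Fin d1 × Fin d2) × Fin D × Fin D) ((Fin d1 × Fin d2) × Fin D × Fin D) ℂ)
    (hP : P = ((Fintype.card G : ℂ) ^ 2)⁻¹ •
      ∑ g : G, ∑ h : G, (τ1 g ⊗ₖ τ2 h) ⊗ₖ (ω g ⊗ₖ ω h))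
    -- the SPAM matrix Θ
    (Θ : Matrix ((Fin d1 × Fin d2) × Fin D × Fin D) ((Fin d1 × Fin d2) × Fin D × Fin D) ℂ)
    (hΘ : Θ = P * (∑ x : X, ∑ y : X,
      B x y ⊗ₖ (vecMulVec (ΛR.mulVec ρ) (ℓ x ᵥ* ΛL) ⊗ₖ vecMulVec (ΛR.mulVec ρ) (ℓ y ᵥ* ΛL))) * P)
    -- the decay matrix Φ
    (Φ : Matrix ((Fin d1 × Fin d2) × Fin D × Fin D) ((Fin d1 × Fin d2) × Fin D × Fin D) ℂ)
    (hΦ : Φ = P * (A ⊗ₖ (Λ ⊗ₖ Λ)) * P) :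
    ∀ m : ℕ, kA m = Matrix.trace (Θ * Φ ^ m) := by
  intro m
  have hcard : ((Fintype.card G : ℂ) ^ 2) ≠ 0 := by simp
  set T : G → G → Matrix ((Fin d1 × Fin d2) × Fin D × Fin D) ((Fin d1 × Fin d2) × Fin D × Fin D) ℂ :=
    fun g h => (τ1 g ⊗ₖ τ2 h) ⊗ₖ (ω g ⊗ₖ ω h) with hT
  have hTmul : ∀ a b c d, T a b * T c d = T (a * c) (b * d) := by
    intro a b c d
    simp only [hT, ← Matrix.mul_kronecker_mul, hω, hτ1, hτ2]
  set S := ∑ g : G, ∑ h : G, T g h with hS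
  have hTS : ∀ a b, T a b * S = S := by
    intro a b
    simp only [hS, Finset.mul_sum, hTmul]
    rw [← Equiv.sum_comp (Equiv.mulLeft a) (fun g => ∑ h : G, T g h)]
    refine Finset.sum_congr rfl fun g _ => ?_
    exact Equiv.sum_comp (Equiv.mulLeft b) (fun h => T (a * g) h)
  have hSS : S * S = ((Fintype.card G : ℂ) ^ 2) • S := by
    conv_lhs => enter [1]; rw [hS]
    simp only [Finset.sum_mul, hTS, Finset.sum_const, Finset.card_univ, smul_smul]
    rw [← Nat.cast_smul_eq_nsmul ℂ]
    congr 1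
    push_cast
    ring
  have hPP : P * P = P := by
    rw [hP, smul_mul_smul_comm, hSS, smul_smul]
    congr 1
    field_simp
  set M := A ⊗ₖ (Λ ⊗ₖ Λ) with hM
  set C := ∑ x : X, ∑ y : X,
      B x y ⊗ₖ (vecMulVec (ΛR.mulVec ρ) (ℓ x ᵥ* ΛL) ⊗ₖ vecMulVec (ΛR.mulVec ρ) (ℓ y ᵥ* ΛL)) with hC
  have hR : Matrix.trace (Θ * Φ ^ m) = Matrix.trace (C * (P * (M * P) ^ m)) := by
    obtain ⟨h1, h2⟩ := aux_proj P M hPP m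
    rw [hΘ, hΦ, mul_assoc (P * C), h1, mul_assoc P C, Matrix.trace_mul_comm P, mul_assoc, h2]
  have hterm : ∀ g1 g2 : Fin (m + 1) → G, ∑ x : X, ∑ y : X,
      fA x y m g1 g2 * p x (m + 1) g1 * p y (m + 1) g2 =
      Matrix.trace (C * (T (g1 (Fin.last m)) (g2 (Fin.last m)) *
        (List.ofFn fun i : Fin m => M * T (g1 i.castSucc) (g2 i.castSucc)).reverse.prod)) := by
    intro g1 g2
    have hl : (List.ofFn fun i : Fin m => M * T (g1 i.castSucc) (g2 i.castSucc)).reverse.prod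
        = (List.ofFn fun i : Fin m =>
            A * (τ1 (g1 i.castSucc) ⊗ₖ τ2 (g2 i.castSucc))).reverse.prod ⊗ₖ
          ((List.ofFn fun i : Fin m => Λ * ω (g1 i.castSucc)).reverse.prod ⊗ₖ
           (List.ofFn fun i : Fin m => Λ * ω (g2 i.castSucc)).reverse.prod) := by
      rw [← aux_kron, ← aux_kron]
      simp only [hM, hT, ← Matrix.mul_kronecker_mul]
    rw [hl]
    simp only [hC, Finset.sum_mul, Matrix.trace_sum]
    refine Finset.sum_congr rfl fun x _ => Finset.sum_congr rfl fun y _ => ?_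
    simp only [hT, ← Matrix.mul_kronecker_mul, Matrix.trace_kronecker]
    rw [hfA, hp, hp]
    simp only [List.ofFn_succ', List.concat_eq_append, List.reverse_append, List.reverse_cons,
      List.reverse_nil, List.nil_append, List.singleton_append, List.prod_cons]
    rw [aux_p, aux_p, hΛ]
    simp only [mul_assoc]
  rw [hkA, hR]
  simp only [hterm]
  simp only [← Matrix.trace_sum, ← Finset.mul_sum]
  rw [aux_snoc (fun a b => M * T a b) T m]
  simp only [← Finset.mul_sum]
  rw [← hS, hP, Matrix.mul_smul, smul_pow, smul_mul_smul_comm, Matrix.mul_smul, Matrix.trace_smul,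
    smul_eq_mul]
  congr 1
  rw [← pow_succ', inv_pow, ← pow_mul]
end

section
/- In the setting of the generalized UIRS protocol with identical sequences (finite group G, matrix representations ω : G → M_D(ℂ) and τ : G → M_{d_τ}(ℂ), matrices Λ_L, Λ_R ∈ M_D(ℂ) with Λ = Λ_R·Λ_L, finite outcome set X with row vectors ℓ_x ∈ ℂ^D, column vector ρ ∈ ℂ^D, matrices B_{xy}, A ∈ M_{d_τ}(ℂ), and with p(x,g⃗), f_A, k_A(m), P, Θ, Φ defined exactly as in Theorem 2), assume in addition that P ≠ 0 and that for every M ∈ M_{d_τ·D²}(ℂ) there exists a scalar c(M) ∈ ℂ with P·M·P = c(M)·P (as holds when the representation ω⊗ω contains exactly one copy of the irreducible representation τ). Then Tr(P) ≠ 0 and, setting p = Tr(P·(A⊗Λ⊗Λ)·P)/Tr(P), one has k_A(m) = Tr(Θ)·p^{m−1} for every m ≥ 1. -/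
open Matrix Kronecker BigOperators

theorem ofFn_rev_prod_succ {R : Type*} [Monoid R] (m : ℕ) (f : Fin (m + 1) → R) :
    (List.ofFn f).reverse.prod = (List.ofFn fun i : Fin m => f i.succ).reverse.prod * f 0 := by
  simp [List.ofFn_succ]

theorem sum_prod_aux {R G : Type*} [Ring R] [Fintype G] (F : G → R) (m : ℕ) :
    ∑ g : Fin m → G, (List.ofFn fun i : Fin m => F (g i)).reverse.prod = (∑ g, F g) ^ m := by
  induction m with
  | zero => simp
  | succ m ih =>
    rw [← (Fin.consEquiv (fun _ : Fin (m + 1) => G)).sum_comp, Fintype.sum_prod_type_right,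
      pow_succ, ← ih, Finset.sum_mul]
    refine Finset.sum_congr rfl fun g _ => ?_
    rw [Finset.mul_sum]
    refine Finset.sum_congr rfl fun a _ => ?_
    rw [ofFn_rev_prod_succ]
    simp [Fin.consEquiv]

theorem sum_prod_last {R G : Type*} [Ring R] [Fintype G] (T : G → R) (K : R) (m : ℕ) :
    ∑ g : Fin (m + 1) → G, T (g (Fin.last m)) *
      (List.ofFn fun i : Fin m => K * T (g i.castSucc)).reverse.prod
      = (∑ g, T g) * (K * ∑ g, T g) ^ m := by
  rw [← (Fin.snocEquiv (fun _ : Fin (m + 1) => G)).sum_comp, Fintype.sum_prod_type,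
    Finset.mul_sum, ← sum_prod_aux (fun g => K * T g), Finset.sum_mul]
  refine Finset.sum_congr rfl fun a _ => ?_
  rw [Finset.mul_sum]
  refine Finset.sum_congr rfl fun g _ => ?_
  simp [Fin.snocEquiv]

theorem kron_prod {n k : Type*} [Fintype n] [DecidableEq n] [Fintype k] [DecidableEq k]
    (m : ℕ) (a : Fin m → Matrix n n ℂ) (b : Fin m → Matrix k k ℂ) :
    (List.ofFn a).reverse.prod ⊗ₖ ((List.ofFn b).reverse.prod ⊗ₖ (List.ofFn b).reverse.prod)
      = (List.ofFn fun i => a i ⊗ₖ (b i ⊗ₖ b i)).reverse.prod := by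
  induction m with
  | zero => simp
  | succ m ih =>
    simp only [ofFn_rev_prod_succ, mul_kronecker_mul, ih]

theorem shift_prod {R G : Type*} [Ring R] (w : G → R) (L L' : R) (m : ℕ) (g : Fin (m + 1) → G) :
    (List.ofFn fun i => L * w (g i) * L').reverse.prod
      = L * (w (g (Fin.last m)) *
        (List.ofFn fun i : Fin m => L' * L * w (g i.castSucc)).reverse.prod) * L' := by
  induction m with
  | zero => simp
  | succ m ih =>
    rw [ofFn_rev_prod_succ, ih (fun i => g i.succ), ofFn_rev_prod_succ m]
    simp only [mul_assoc, Fin.succ_last, Fin.succ_castSucc, Fin.castSucc_zero]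

theorem dot_trace {n : Type*} [Fintype n] [DecidableEq n] (l r : n → ℂ) (L W R : Matrix n n ℂ) :
    l ⬝ᵥ (L * W * R).mulVec r = trace (vecMulVec (R.mulVec r) (l ᵥ* L) * W) := by
  rw [vecMulVec_mul, trace_vecMulVec, dotProduct_comm (R.mulVec r), vecMul_vecMul,
    ← dotProduct_mulVec, mulVec_mulVec]

/-- Single-copy special case of Theorem 2 of the paper: if the group-averaged projector `P`
of the identical-sequence UIRS protocol is nonzero and compresses every matrix to a scalar
multiple of itself (`P·M·P = c(M)·P`), then `Tr P ≠ 0` and the identical-sequence correlator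
decays as a single exponential, `k_A(m) = Tr(Θ) · p^{m-1}` with
`p = Tr(P·(A⊗Λ⊗Λ)·P)/Tr(P)`.  Sequence length `m ≥ 1` is represented as `m + 1`. -/
theorem statement3
    (G : Type) [Fintype G] [Group G]
    (D dτ : ℕ) (hD : 0 < D) (hdτ : 0 < dτ)
    (ω : G → Matrix (Fin D) (Fin D) ℂ)
    (τ : G → Matrix (Fin dτ) (Fin dτ) ℂ)
    (hω1 : ω 1 = 1) (hω : ∀ g h : G, ω (g * h) = ω g * ω h)
    (hτ1 : τ 1 = 1) (hτ : ∀ g h : G, τ (g * h) = τ g * τ h)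
    (ΛL ΛR Λ : Matrix (Fin D) (Fin D) ℂ) (hΛ : Λ = ΛR * ΛL)
    (X : Type) [Fintype X]
    (ℓ : X → Fin D → ℂ) (ρ : Fin D → ℂ)
    (B : X → X → Matrix (Fin dτ) (Fin dτ) ℂ)
    (A : Matrix (Fin dτ) (Fin dτ) ℂ)
    -- the outcome probability p(x, g⃗) = ℓ_x (Λ_L ω(g_m) Λ_R) ⋯ (Λ_L ω(g_1) Λ_R) ρ
    (p : X → (m : ℕ) → (Fin m → G) → ℂ)
    (hp : ∀ (x : X) (m : ℕ) (g : Fin m → G),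
      p x m g = ℓ x ⬝ᵥ ((List.ofFn fun i : Fin m => ΛL * ω (g i) * ΛR).reverse.prod).mulVec ρ)
    -- the sequence correlation function f_A(x, y, g⃗)
    (fA : X → X → (m : ℕ) → (Fin (m + 1) → G) → ℂ)
    (hfA : ∀ (x y : X) (m : ℕ) (g : Fin (m + 1) → G),
      fA x y m g =
        Matrix.trace (B x y * τ (g (Fin.last m)) *
          (List.ofFn fun i : Fin m => A * τ (g i.castSucc)).reverse.prod))
    -- the identical-sequence correlator k_A at sequence length m + 1
    (kA : ℕ → ℂ)
    (hkA : ∀ m : ℕ,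
      kA m = ((Fintype.card G : ℂ) ^ (m + 1))⁻¹ *
        ∑ g : Fin (m + 1) → G, ∑ x : X, ∑ y : X,
          fA x y m g * p x (m + 1) g * p y (m + 1) g)
    -- the group-averaged projector P on ℂ^{dτ} ⊗ ℂ^D ⊗ ℂ^D
    (P : Matrix (Fin dτ × Fin D × Fin D) (Fin dτ × Fin D × Fin D) ℂ)
    (hP : P = ((Fintype.card G : ℂ))⁻¹ • ∑ g : G, τ g ⊗ₖ (ω g ⊗ₖ ω g))
    -- the SPAM matrix Θ
    (Θ : Matrix (Fin dτ × Fin D × Fin D) (Fin dτ × Fin D × Fin D) ℂ)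
    (hΘ : Θ = P * (∑ x : X, ∑ y : X,
      B x y ⊗ₖ (vecMulVec (ΛR.mulVec ρ) (ℓ x ᵥ* ΛL) ⊗ₖ vecMulVec (ΛR.mulVec ρ) (ℓ y ᵥ* ΛL))) * P)
    -- single-copy assumptions
    (hPne : P ≠ 0)
    (hscalar : ∀ M : Matrix (Fin dτ × Fin D × Fin D) (Fin dτ × Fin D × Fin D) ℂ,
      ∃ c : ℂ, P * M * P = c • P) :
    Matrix.trace P ≠ 0 ∧
      ∀ m : ℕ, kA m = Matrix.trace Θ *
        (Matrix.trace (P * (A ⊗ₖ (Λ ⊗ₖ Λ)) * P) / Matrix.trace P) ^ m := by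
  classical
  set T : G → Matrix (Fin dτ × Fin D × Fin D) (Fin dτ × Fin D × Fin D) ℂ :=
    fun g => τ g ⊗ₖ (ω g ⊗ₖ ω g) with hT
  have hN : (Fintype.card G : ℂ) ≠ 0 := by
    exact_mod_cast Fintype.card_ne_zero
  have hTm : ∀ g h, T g * T h = T (g * h) := by
    intro g h
    simp only [hT, hτ, hω, mul_kronecker_mul]
  set S := ∑ g, T g with hS
  have hSS : S * S = (Fintype.card G : ℂ) • S := by
    conv_lhs => rw [hS]
    rw [Finset.sum_mul]
    have : ∀ g ∈ Finset.univ, T g * S = S := by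
      intro g _
      rw [hS, Finset.mul_sum]
      simp only [hTm]
      exact Equiv.sum_comp (Equiv.mulLeft g) T
    rw [Finset.sum_congr rfl this]
    simp [← Nat.cast_smul_eq_nsmul ℂ]
  have hPP : P * P = P := by
    rw [hP, smul_mul_assoc, mul_smul_comm, hSS, smul_smul, smul_smul]
    congr 1
    field_simp
  have htr : ∀ M, trace (P * M * P) = trace (M * P) := by
    intro M
    rw [mul_assoc, trace_mul_comm, mul_assoc, hPP]
  have hPtr : trace P ≠ 0 := by
    intro h0
    apply hPne
    apply Matrix.ext_iff_trace_mul_left.mpr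
    intro M
    obtain ⟨c, hc⟩ := hscalar M
    rw [← htr, hc]
    simp [h0]
  refine ⟨hPtr, fun m => ?_⟩
  obtain ⟨c, hc⟩ := hscalar (A ⊗ₖ (Λ ⊗ₖ Λ))
  set K := A ⊗ₖ (Λ ⊗ₖ Λ) with hK
  have hpow : ∀ m, P * (K * P) ^ m = c ^ m • P := by
    intro m
    induction m with
    | zero => simp
    | succ m ih =>
      rw [pow_succ, ← mul_assoc, ih, smul_mul_assoc, ← mul_assoc, hc, smul_smul, pow_succ]
  rw [hc, trace_smul, smul_eq_mul, mul_div_assoc, div_self hPtr, mul_one]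
  set C := ∑ x : X, ∑ y : X,
      B x y ⊗ₖ (vecMulVec (ΛR.mulVec ρ) (ℓ x ᵥ* ΛL) ⊗ₖ vecMulVec (ΛR.mulVec ρ) (ℓ y ᵥ* ΛL))
    with hC
  have hterm : ∀ g : Fin (m + 1) → G, ∑ x : X, ∑ y : X,
      fA x y m g * p x (m + 1) g * p y (m + 1) g
      = trace (C * (T (g (Fin.last m)) *
        (List.ofFn fun i : Fin m => K * T (g i.castSucc)).reverse.prod)) := by
    intro g
    rw [hC, Finset.sum_mul, trace_sum]
    refine Finset.sum_congr rfl fun x _ => ?_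
    rw [Finset.sum_mul, trace_sum]
    refine Finset.sum_congr rfl fun y _ => ?_
    rw [hfA, hp, hp, shift_prod, dot_trace, dot_trace, ← hΛ]
    have hKT : (fun i : Fin m => K * T (g i.castSucc)) = fun i : Fin m =>
        (A * τ (g i.castSucc)) ⊗ₖ ((Λ * ω (g i.castSucc)) ⊗ₖ (Λ * ω (g i.castSucc))) := by
      funext i
      simp only [hK, hT, mul_kronecker_mul]
    rw [hKT, ← kron_prod]
    simp only [hT]
    rw [← mul_kronecker_mul, ← mul_kronecker_mul, ← mul_kronecker_mul, ← mul_kronecker_mul,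
      trace_kronecker, trace_kronecker]
    simp only [mul_assoc]
  rw [hkA, Finset.sum_congr rfl fun g _ => hterm g, ← trace_sum, ← Finset.mul_sum,
    sum_prod_last, ← hS]
  have hSP : S = (Fintype.card G : ℂ) • P := by
    rw [hP, smul_smul, mul_inv_cancel₀ hN, one_smul]
  rw [hSP, mul_smul_comm, smul_pow, smul_mul_assoc, mul_smul_comm _ P, smul_smul, ← pow_succ', hpow,
    mul_smul_comm, mul_smul_comm, trace_smul, trace_smul, hΘ, htr, smul_eq_mul, smul_eq_mul,
    inv_mul_cancel_left₀ (pow_ne_zero _ hN), mul_comm]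
end

section
/- Fix an integer n ≥ 1 and let d = 2^n. Let V and W be nontrivial Pauli strings (so Tr V = 0, Tr W = 0, V² = W² = I_d) and let U ∈ M_d(ℂ) be unitary. Then Σ_{σ ∈ 𝒫⁰} Tr(WσWσ)·(Tr(σ·U V U†))² = Tr(W·U V U†·W·U V U†). In particular the decay parameter of the OTOC correlator equals d·O(t), where O(t) = (1/d)·Tr(W·U V U†·W·U V U†) is the out-of-time-ordered correlator at infinite temperature. -/
open Matrix Kronecker BigOperators

noncomputable section

/-- The 2×2 Pauli matrices `I₂, X, Y, Z`, indexed by `Fin 4`. -/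
def pauli : Fin 4 → Matrix (Fin 2) (Fin 2) ℂ
  | 0 => 1
  | 1 => !![0, 1; 1, 0]
  | 2 => !![0, -Complex.I; Complex.I, 0]
  | 3 => !![1, 0; 0, -1]

/-- The Pauli string `pauli (s 0) ⊗ ⋯ ⊗ pauli (s (n-1))`, realized as a matrix on
`ℂ^{2^n}` with the index set `Fin n → Fin 2` (so `d = 2^n`).  The string is trivial
(equal to `I_d`) exactly when `s = fun _ => 0`. -/
def pauliString {n : ℕ} (s : Fin n → Fin 4) :
    Matrix (Fin n → Fin 2) (Fin n → Fin 2) ℂ :=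
  Matrix.of fun i j => ∏ k : Fin n, pauli (s k) (i k) (j k)

/-- The normalized Pauli operator `σ_s / √d` with `d = 2^n`; these form the
orthonormal basis `𝒫` of `M_d(ℂ)` for the Hilbert–Schmidt inner product. -/
def normPauli {n : ℕ} (s : Fin n → Fin 4) :
    Matrix (Fin n → Fin 2) (Fin n → Fin 2) ℂ :=
  ((Real.sqrt (2 ^ n) : ℂ))⁻¹ • pauliString s

/-- The swap operator `F` on `ℂ^d ⊗ ℂ^d`, determined by `F (u ⊗ v) = v ⊗ u`. -/
def swapOp (I : Type*) [DecidableEq I] : Matrix (I × I) (I × I) ℂ :=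
  Matrix.of fun p q => if p.1 = q.2 ∧ p.2 = q.1 then 1 else 0

/-- Kronecker product of a family of 2×2 matrices. -/
def tens {n : ℕ} (M : Fin n → Matrix (Fin 2) (Fin 2) ℂ) :
    Matrix (Fin n → Fin 2) (Fin n → Fin 2) ℂ :=
  Matrix.of fun i j => ∏ k : Fin n, M k (i k) (j k)

lemma pauliString_eq_tens {n : ℕ} (s : Fin n → Fin 4) :
    pauliString s = tens (fun k => pauli (s k)) := rfl

lemma tens_mul {n : ℕ} (M N : Fin n → Matrix (Fin 2) (Fin 2) ℂ) :
    tens M * tens N = tens (fun k => M k * N k) := by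
  ext i j
  simp only [tens, Matrix.mul_apply, Matrix.of_apply, ← Finset.prod_mul_distrib]
  rw [Finset.prod_univ_sum, Fintype.piFinset_univ]

lemma tens_smul {n : ℕ} (c : Fin n → ℂ) (M : Fin n → Matrix (Fin 2) (Fin 2) ℂ) :
    tens (fun k => c k • M k) = (∏ k, c k) • tens M := by
  ext i j
  simp [tens, Finset.prod_mul_distrib]

lemma tens_one {n : ℕ} : tens (fun _ : Fin n => (1 : Matrix (Fin 2) (Fin 2) ℂ)) = 1 := by
  ext i j
  simp only [tens, Matrix.of_apply, Matrix.one_apply]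
  rw [Finset.prod_ite_zero]
  simp [funext_iff]

lemma tens_trace {n : ℕ} (M : Fin n → Matrix (Fin 2) (Fin 2) ℂ) :
    Matrix.trace (tens M) = ∏ k, Matrix.trace (M k) := by
  simp only [tens, Matrix.trace, Matrix.diag_apply, Matrix.of_apply]
  rw [Finset.prod_univ_sum, Fintype.piFinset_univ]

lemma pauli_sq (a : Fin 4) : pauli a * pauli a = 1 := by
  fin_cases a <;> ext i j <;> fin_cases i <;> fin_cases j <;>
    simp [pauli, Matrix.mul_apply, Fin.sum_univ_two]

lemma pauli_conj (a b : Fin 4) :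
    ∃ e : ℂ, pauli a * pauli b * pauli a = e • pauli b := by
  by_cases h : a = 0 ∨ b = 0 ∨ a = b
  · refine ⟨1, ?_⟩
    rcases h with rfl | rfl | rfl
    · simp [pauli]
    · have := pauli_sq a
      simpa [pauli] using this
    · rw [pauli_sq]; simp
  · refine ⟨-1, ?_⟩
    push Not at h
    fin_cases a <;> fin_cases b <;> first | (exfalso; revert h; decide) | skip
    all_goals
      ext i j
      fin_cases i <;> fin_cases j <;>
        simp [pauli, Matrix.mul_apply, Fin.sum_univ_two]

lemma pauli_trace (a : Fin 4) (h : a ≠ 0) : Matrix.trace (pauli a) = 0 := by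
  fin_cases a <;> simp [pauli, Matrix.trace, Fin.sum_univ_two] at h ⊢

lemma pauli_complete (i j k l : Fin 2) :
    ∑ a, pauli a i j * pauli a k l = if i = l ∧ j = k then 2 else 0 := by
  rw [Fin.sum_univ_four]
  fin_cases i <;> fin_cases j <;> fin_cases k <;> fin_cases l <;>
    simp [pauli] <;> norm_num

lemma pauliString_complete {n : ℕ} (i j k l : Fin n → Fin 2) :
    ∑ s, pauliString s i j * pauliString s k l = if i = l ∧ j = k then 2 ^ n else 0 := by
  simp only [pauliString, Matrix.of_apply, ← Finset.prod_mul_distrib]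
  rw [← Fintype.piFinset_univ, ← Finset.prod_univ_sum (fun _ => Finset.univ)
    (fun m a => pauli a (i m) (j m) * pauli a (k m) (l m))]
  simp only [pauli_complete]
  rw [Finset.prod_ite_zero]
  simp [funext_iff, forall_and]

lemma expand {n : ℕ} (A : Matrix (Fin n → Fin 2) (Fin n → Fin 2) ℂ) :
    ∑ s, Matrix.trace (pauliString s * A) • pauliString s = (2 ^ n : ℂ) • A := by
  ext k l
  simp only [Matrix.sum_apply, Matrix.smul_apply, smul_eq_mul, Matrix.trace,
    Matrix.diag_apply, Matrix.mul_apply, Finset.sum_mul]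
  rw [Finset.sum_comm]
  have h : ∀ i j : Fin n → Fin 2, ∑ s, pauliString s i j * A j i * pauliString s k l
      = if i = l ∧ j = k then 2 ^ n * A j i else 0 := by
    intro i j
    have := pauliString_complete i j k l
    calc _ = (∑ s, pauliString s i j * pauliString s k l) * A j i := by
            rw [Finset.sum_mul]; exact Finset.sum_congr rfl fun _ _ => by ring
      _ = _ := by rw [this]; simp
  calc _ = ∑ i, ∑ j, (if i = l ∧ j = k then 2 ^ n * A j i else 0) := by
        refine Finset.sum_congr rfl fun i _ => ?_
        rw [Finset.sum_comm]
        exact Finset.sum_congr rfl fun j _ => h i j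
    _ = _ := by simp [ite_and]

lemma pauliString_sq {n : ℕ} (s : Fin n → Fin 4) : pauliString s * pauliString s = 1 := by
  rw [pauliString_eq_tens, tens_mul]
  simp only [pauli_sq, tens_one]

lemma pauliString_conj {n : ℕ} (s t : Fin n → Fin 4) :
    ∃ e : ℂ, pauliString s * pauliString t * pauliString s = e • pauliString t := by
  choose e he using pauli_conj
  refine ⟨∏ k, e (s k) (t k), ?_⟩
  simp only [pauliString_eq_tens, tens_mul, he]
  exact tens_smul _ _

lemma pauliString_trace {n : ℕ} (s : Fin n → Fin 4) (h : s ≠ fun _ => 0) :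
    Matrix.trace (pauliString s) = 0 := by
  obtain ⟨k, hk⟩ := Function.ne_iff.mp h
  rw [pauliString_eq_tens, tens_trace]
  exact Finset.prod_eq_zero (Finset.mem_univ k) (pauli_trace _ hk)

/-- Core computation of Corollary 1 of the paper: for nontrivial Pauli strings `V`, `W`
and a unitary `U`, `Σ_{σ ∈ 𝒫⁰} Tr(WσWσ)·(Tr(σ·UVU†))² = Tr(W·UVU†·W·UVU†)`,
i.e. the decay parameter of the OTOC correlator equals `d·O(t)`. -/
theorem statement4 (n : ℕ) (hn : 1 ≤ n)
    (sV sW : Fin n → Fin 4) (hV : sV ≠ fun _ => 0) (hW : sW ≠ fun _ => 0)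
    (U : Matrix (Fin n → Fin 2) (Fin n → Fin 2) ℂ)
    (hU : U * Uᴴ = 1) (hU' : Uᴴ * U = 1) :
    ∑ s ∈ Finset.univ.filter (fun s : Fin n → Fin 4 => s ≠ fun _ => 0),
      Matrix.trace (pauliString sW * normPauli s * pauliString sW * normPauli s) *
        (Matrix.trace (normPauli s * (U * pauliString sV * Uᴴ))) ^ 2
    = Matrix.trace (pauliString sW * (U * pauliString sV * Uᴴ) *
        pauliString sW * (U * pauliString sV * Uᴴ)) := by
  set A := U * pauliString sV * Uᴴ with hA
  have hA0 : Matrix.trace A = 0 := by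
    rw [hA, Matrix.trace_mul_comm, ← Matrix.mul_assoc, hU', Matrix.one_mul]
    exact pauliString_trace sV hV
  have hD : (2 ^ n : ℂ) ≠ 0 := pow_ne_zero _ two_ne_zero
  have hr : ((Real.sqrt (2 ^ n) : ℂ))⁻¹ ^ 2 = (2 ^ n : ℂ)⁻¹ := by
    rw [inv_pow, ← Complex.ofReal_pow, Real.sq_sqrt (by positivity)]
    simp
  set r := ((Real.sqrt (2 ^ n) : ℂ))⁻¹
  set W := pauliString sW
  choose e he using fun t => pauliString_conj sW t
  have h1 : ∀ s, Matrix.trace (W * normPauli s * W * normPauli s) = e s := by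
    intro s
    have : W * normPauli s * W * normPauli s = (r ^ 2 * e s) • 1 := by
      simp only [normPauli, Matrix.mul_smul, Matrix.smul_mul]
      rw [he s, Matrix.smul_mul, pauliString_sq, smul_smul, smul_smul]
      congr 1
      ring
    rw [this, Matrix.trace_smul, hr, Matrix.trace_one]
    simp
    field_simp
  have h2 : ∀ s, Matrix.trace (normPauli s * A) ^ 2
      = (2 ^ n : ℂ)⁻¹ * Matrix.trace (pauliString s * A) ^ 2 := by
    intro s
    rw [normPauli, Matrix.smul_mul, Matrix.trace_smul, smul_eq_mul, mul_pow, hr]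
  rw [Finset.sum_filter_of_ne]
  · simp only [h1, h2]
    apply mul_left_cancel₀ hD
    calc _ = ∑ s, e s * Matrix.trace (pauliString s * A) ^ 2 := by
          rw [Finset.mul_sum]
          refine Finset.sum_congr rfl fun s _ => ?_
          field_simp
      _ = Matrix.trace (W * ((2 ^ n : ℂ) • A) * W * A) := by
          rw [← expand A]
          simp only [Matrix.mul_sum, Matrix.sum_mul, Matrix.trace_sum, Matrix.mul_smul,
            Matrix.smul_mul, Matrix.trace_smul]
          refine Finset.sum_congr rfl fun s _ => ?_
          rw [he s, Matrix.smul_mul, Matrix.trace_smul, smul_eq_mul, smul_eq_mul]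
          ring
      _ = _ := by
          simp only [Matrix.mul_smul, Matrix.smul_mul, Matrix.trace_smul, smul_eq_mul]
  · intro s _ hs h0
    apply hs
    have : pauliString s = 1 := by
      rw [pauliString_eq_tens, h0]
      exact tens_one
    rw [h2, this, Matrix.one_mul, hA0]
    simp

end
end

section
/- Let d ≥ 2 and let G be a finite subgroup of the d×d unitary matrices satisfying the unitary 2-design conditions: (i) for every X ∈ M_d(ℂ), (1/|G|)·Σ_{g∈G} g X g† = (Tr X/d)·I_d, and (ii) for all traceless X, Y ∈ M_d(ℂ), (1/|G|)·Σ_{g∈G} (g X g†)⊗(g Y g†) = (Tr(XY)/(d²−1))·(F − I_{d²}/d). Let Λ_L, Λ_R : M_d(ℂ) → M_d(ℂ) be linear maps such that Λ = Λ_R∘Λ_L is trace-preserving, and let E, ρ ∈ M_d(ℂ) be arbitrary. Define the unitarity u = Tr(B₂·(Λ⊗Λ)(B₂)) where B₂ = (F − I_{d²}/d)/√(d²−1) and Λ⊗Λ is the induced map on M_{d²}(ℂ), and assume u ≠ 1. Then there exist constants a, b ∈ ℂ such that for every m ≥ 1: (1/|G|^m)·Σ_{(g_1,…,g_m)∈G^m}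 ( Tr( E · (Λ_L∘Ad_{g_m}∘Λ_R)∘(Λ_L∘Ad_{g_{m−1}}∘Λ_R)∘⋯∘(Λ_L∘Ad_{g_1}∘Λ_R)(ρ) ) )² = a + b·u^{m−1}, where Ad_g(M) = g M g†. -/
open Matrix Kronecker BigOperators

noncomputable section

/-- The conjugation (adjoint) channel `Ad_g : M ↦ g M g†` as a linear endomorphism. -/
def adMap {d : ℕ} (g : Matrix (Fin d) (Fin d) ℂ) :
    Module.End ℂ (Matrix (Fin d) (Fin d) ℂ) where
  toFun M := g * M * gᴴ
  map_add' M N := by simp [Matrix.mul_add, Matrix.add_mul]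
  map_smul' c M := by simp [Matrix.mul_smul, Matrix.smul_mul]

/-- The induced map `Φ ⊗ Φ` on Kronecker products. -/
def tensMap {d : ℕ} (Φ : Module.End ℂ (Matrix (Fin d) (Fin d) ℂ)) :
    Matrix (Fin d × Fin d) (Fin d × Fin d) ℂ →ₗ[ℂ]
      Matrix (Fin d × Fin d) (Fin d × Fin d) ℂ :=
  (kroneckerLinearEquiv (Fin d) (Fin d) (Fin d) (Fin d) ℂ).toLinearMap ∘ₗ
    TensorProduct.map Φ Φ ∘ₗ
    (kroneckerLinearEquiv (Fin d) (Fin d) (Fin d) (Fin d) ℂ).symm.toLinearMap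

theorem tensMap_kron {d : ℕ} (Φ : Module.End ℂ (Matrix (Fin d) (Fin d) ℂ))
    (M N : Matrix (Fin d) (Fin d) ℂ) : tensMap Φ (M ⊗ₖ N) = Φ M ⊗ₖ Φ N := by
  simp [tensMap]

theorem kron_ext {d : ℕ} {W : Type*} [AddCommMonoid W] [Module ℂ W]
    (f g : Matrix (Fin d × Fin d) (Fin d × Fin d) ℂ →ₗ[ℂ] W)
    (h : ∀ M N : Matrix (Fin d) (Fin d) ℂ, f (M ⊗ₖ N) = g (M ⊗ₖ N)) : f = g := by
  refine LinearMap.ext fun Z => ?_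
  obtain ⟨t, rfl⟩ := (kroneckerLinearEquiv (Fin d) (Fin d) (Fin d) (Fin d) ℂ).surjective Z
  induction t with
  | zero => simp
  | tmul x y => simpa using h x y
  | add x y hx hy => rw [map_add, map_add, map_add, hx, hy]

theorem trace_swap_kron {d : ℕ} (M N : Matrix (Fin d) (Fin d) ℂ) :
    Matrix.trace (swapOp (Fin d) * (M ⊗ₖ N)) = Matrix.trace (M * N) := by
  simp only [Matrix.trace, Matrix.diag, Matrix.mul_apply, swapOp, Matrix.of_apply,
    Matrix.kroneckerMap_apply, Fintype.sum_prod_type, ite_and, ite_mul, one_mul, zero_mul]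
  rw [Finset.sum_comm]
  refine Finset.sum_congr rfl fun i _ => Finset.sum_congr rfl fun j _ => ?_
  rw [Finset.sum_eq_single i]
  · simp
  · intro b _ hb
    simp [hb.symm]
  · simp

theorem trace_swap {d : ℕ} : Matrix.trace (swapOp (Fin d)) = d := by
  have := trace_swap_kron (1 : Matrix (Fin d) (Fin d) ℂ) 1
  simpa using this

/-- The averaged twirl. -/
theorem twirl (d : ℕ) (hd : 2 ≤ d)
    (G : Finset (Matrix (Fin d) (Fin d) ℂ))
    (hGunitary : ∀ g ∈ G, g * gᴴ = 1 ∧ gᴴ * g = 1)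
    (hG : (G.card : ℂ) ≠ 0)
    (hdesign1 : ∀ M : Matrix (Fin d) (Fin d) ℂ,
      (G.card : ℂ)⁻¹ • ∑ g ∈ G, g * M * gᴴ = (Matrix.trace M / (d : ℂ)) • 1)
    (hdesign2 : ∀ M N : Matrix (Fin d) (Fin d) ℂ,
      Matrix.trace M = 0 → Matrix.trace N = 0 →
      (G.card : ℂ)⁻¹ • ∑ g ∈ G, (g * M * gᴴ) ⊗ₖ (g * N * gᴴ) =
        (Matrix.trace (M * N) / ((d : ℂ) ^ 2 - 1)) •
          (swapOp (Fin d) - ((d : ℂ))⁻¹ • 1))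
    (Z : Matrix (Fin d × Fin d) (Fin d × Fin d) ℂ) :
    (G.card : ℂ)⁻¹ • ∑ g ∈ G, tensMap (adMap g) Z =
      (((d : ℂ) ^ 2)⁻¹ * Matrix.trace Z) • 1 +
      (((d : ℂ) ^ 2 - 1)⁻¹ * Matrix.trace ((swapOp (Fin d) - ((d : ℂ))⁻¹ • 1) * Z)) •
          (swapOp (Fin d) - ((d : ℂ))⁻¹ • 1) := by
  have hd0 : (d : ℂ) ≠ 0 := by
    have : d ≠ 0 := by omega
    exact_mod_cast this
  set K := swapOp (Fin d) - ((d : ℂ))⁻¹ • (1 : Matrix (Fin d × Fin d) (Fin d × Fin d) ℂ) with hK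
  let tr := Matrix.traceLinearMap (Fin d × Fin d) ℂ ℂ
  let f : Matrix (Fin d × Fin d) (Fin d × Fin d) ℂ →ₗ[ℂ]
      Matrix (Fin d × Fin d) (Fin d × Fin d) ℂ := (G.card : ℂ)⁻¹ • ∑ g ∈ G, tensMap (adMap g)
  let f₂ : Matrix (Fin d × Fin d) (Fin d × Fin d) ℂ →ₗ[ℂ]
      Matrix (Fin d × Fin d) (Fin d × Fin d) ℂ :=
    (((d : ℂ) ^ 2)⁻¹ • tr).smulRight 1 +
    (((d : ℂ) ^ 2 - 1)⁻¹ • (tr ∘ₗ LinearMap.mulLeft ℂ K)).smulRight K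
  have key : f = f₂ := by
    apply kron_ext
    intro M N
    obtain ⟨x, M₀, hM₀, rfl⟩ : ∃ (x : ℂ) (M₀ : Matrix (Fin d) (Fin d) ℂ),
        Matrix.trace M₀ = 0 ∧ M = x • 1 + M₀ :=
      ⟨Matrix.trace M / d, M - (Matrix.trace M / d) • 1, by simp; field_simp; simp, by simp⟩
    obtain ⟨y, N₀, hN₀, rfl⟩ : ∃ (y : ℂ) (N₀ : Matrix (Fin d) (Fin d) ℂ),
        Matrix.trace N₀ = 0 ∧ N = y • 1 + N₀ :=
      ⟨Matrix.trace N / d, N - (Matrix.trace N / d) • 1, by simp; field_simp; simp, by simp⟩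
    have h1 : ∀ X : Matrix (Fin d) (Fin d) ℂ, Matrix.trace X = 0 →
        ∑ g ∈ G, g * X * gᴴ = 0 := by
      intro X hX
      have := hdesign1 X
      rw [hX, zero_div, zero_smul] at this
      exact (smul_eq_zero.mp this).resolve_left (inv_ne_zero hG)
    have hf : f ((x • 1 + M₀) ⊗ₖ (y • 1 + N₀)) = (x * y) • 1 +
        (Matrix.trace (M₀ * N₀) / ((d : ℂ) ^ 2 - 1)) • K := by
      have e : ∀ g ∈ G, tensMap (adMap g) ((x • 1 + M₀) ⊗ₖ (y • 1 + N₀)) =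
          (x * y) • 1 + x • ((1 : Matrix (Fin d) (Fin d) ℂ) ⊗ₖ (g * N₀ * gᴴ))
            + y • ((g * M₀ * gᴴ) ⊗ₖ (1 : Matrix (Fin d) (Fin d) ℂ))
            + (g * M₀ * gᴴ) ⊗ₖ (g * N₀ * gᴴ) := by
        intro g hg
        have hA : ∀ (c : ℂ) (X : Matrix (Fin d) (Fin d) ℂ),
            adMap g (c • 1 + X) = c • 1 + g * X * gᴴ := by
          intro c X
          simp [adMap, Matrix.mul_add, Matrix.add_mul, (hGunitary g hg).1]
        rw [tensMap_kron, hA, hA, add_kronecker, kronecker_add, kronecker_add,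
          smul_kronecker, kronecker_smul, one_kronecker_one, smul_kronecker, kronecker_smul,
          smul_smul]
        abel
      have s1 : ∑ g ∈ G, ((1 : Matrix (Fin d) (Fin d) ℂ) ⊗ₖ (g * N₀ * gᴴ)) = 0 := by
        have : ∑ g ∈ G, ((1 : Matrix (Fin d) (Fin d) ℂ) ⊗ₖ (g * N₀ * gᴴ)) =
            (1 : Matrix (Fin d) (Fin d) ℂ) ⊗ₖ (∑ g ∈ G, g * N₀ * gᴴ) := by
          exact (map_sum (kroneckerBilinear (m := Fin d) (l := Fin d) (n := Fin d) (p := Fin d) (R := ℂ) (α := ℂ) (1 : Matrix (Fin d) (Fin d) ℂ)) _ _).symm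
        rw [this, h1 _ hN₀, kronecker_zero]
      have s2 : ∑ g ∈ G, ((g * M₀ * gᴴ) ⊗ₖ (1 : Matrix (Fin d) (Fin d) ℂ)) = 0 := by
        have : ∑ g ∈ G, ((g * M₀ * gᴴ) ⊗ₖ (1 : Matrix (Fin d) (Fin d) ℂ)) =
            (∑ g ∈ G, g * M₀ * gᴴ) ⊗ₖ (1 : Matrix (Fin d) (Fin d) ℂ) := by
          exact (map_sum ((kroneckerBilinear (m := Fin d) (l := Fin d) (n := Fin d) (p := Fin d) (R := ℂ) (α := ℂ)).flip (1 : Matrix (Fin d) (Fin d) ℂ)) _ _).symm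
        rw [this, h1 _ hM₀, zero_kronecker]
      simp only [f, LinearMap.smul_apply, LinearMap.sum_apply]
      rw [Finset.sum_congr rfl e]
      simp only [Finset.sum_add_distrib, ← Finset.smul_sum, s1, s2, smul_zero, add_zero]
      rw [smul_add, hdesign2 _ _ hM₀ hN₀, Finset.sum_const, ← Nat.cast_smul_eq_nsmul ℂ,
        smul_comm (x * y), smul_smul, inv_mul_cancel₀ hG, one_smul]
    rw [hf]
    simp only [f₂, LinearMap.add_apply, LinearMap.smulRight_apply, LinearMap.smul_apply,
      LinearMap.comp_apply, LinearMap.mulLeft_apply, tr, Matrix.traceLinearMap_apply, smul_eq_mul]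
    have t1 : Matrix.trace ((x • (1 : Matrix (Fin d) (Fin d) ℂ) + M₀) ⊗ₖ
        (y • (1 : Matrix (Fin d) (Fin d) ℂ) + N₀)) = x * y * d ^ 2 := by
      rw [trace_kronecker]
      simp [hM₀, hN₀]
      ring
    have t2 : Matrix.trace (K * ((x • (1 : Matrix (Fin d) (Fin d) ℂ) + M₀) ⊗ₖ
        (y • (1 : Matrix (Fin d) (Fin d) ℂ) + N₀))) = Matrix.trace (M₀ * N₀) := by
      rw [hK, Matrix.sub_mul, Matrix.trace_sub, trace_swap_kron, Matrix.smul_mul,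
        Matrix.one_mul, Matrix.trace_smul, t1]
      simp [Matrix.add_mul, Matrix.mul_add, hM₀, hN₀]
      field_simp
      ring
    rw [t1, t2]
    congr 2
    · field_simp
    · ring
  have := LinearMap.congr_fun key Z
  simpa [f, f₂, tr] using this

theorem seq_sum {d : ℕ} (G : Finset (Matrix (Fin d) (Fin d) ℂ))
    (ΛL ΛR : Module.End ℂ (Matrix (Fin d) (Fin d) ℂ)) (ρ : Matrix (Fin d) (Fin d) ℂ)
    (S : ℕ → Matrix (Fin d × Fin d) (Fin d × Fin d) ℂ)
    (hS : ∀ m, S m = ∑ g : Fin m → {g // g ∈ G},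
      (((List.ofFn fun i : Fin m =>
        ΛL * adMap (g i : Matrix (Fin d) (Fin d) ℂ) * ΛR).reverse.prod ρ) ⊗ₖ
       ((List.ofFn fun i : Fin m =>
        ΛL * adMap (g i : Matrix (Fin d) (Fin d) ℂ) * ΛR).reverse.prod ρ))) (m : ℕ) :
    S (m + 1) = tensMap ΛL (∑ h ∈ G, tensMap (adMap h) (tensMap ΛR (S m))) := by
  rw [hS (m + 1), ← (Fin.snocEquiv fun _ => {g // g ∈ G}).sum_comp, Fintype.sum_prod_type,
    map_sum, ← Finset.sum_coe_sort G]
  refine Finset.sum_congr rfl fun h _ => ?_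
  rw [hS m, map_sum, map_sum, map_sum]
  refine Finset.sum_congr rfl fun g _ => ?_
  rw [tensMap_kron, tensMap_kron, tensMap_kron, List.ofFn_succ']
  simp [Fin.snocEquiv, Module.End.mul_apply]

/-- Eq. (40) of the paper (unitarity estimation): for a unitary 2-design `G` with
gate-independent noise `Λ_L, Λ_R` such that `Λ = Λ_R∘Λ_L` is trace preserving and has
unitarity `u ≠ 1`, the averaged squared expectation value of a random gate sequence of
length `m` equals `a + b·u^{m−1}`.  Sequence length `m ≥ 1` is represented as `m + 1`. -/
theorem statement10 (d : ℕ) (hd : 2 ≤ d)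
    -- G is a finite subgroup of the unitary group
    (G : Finset (Matrix (Fin d) (Fin d) ℂ))
    (hGone : (1 : Matrix (Fin d) (Fin d) ℂ) ∈ G)
    (hGmul : ∀ g ∈ G, ∀ h ∈ G, g * h ∈ G)
    (hGinv : ∀ g ∈ G, gᴴ ∈ G)
    (hGunitary : ∀ g ∈ G, g * gᴴ = 1 ∧ gᴴ * g = 1)
    -- the unitary 2-design conditions
    (hdesign1 : ∀ M : Matrix (Fin d) (Fin d) ℂ,
      (G.card : ℂ)⁻¹ • ∑ g ∈ G, g * M * gᴴ = (Matrix.trace M / (d : ℂ)) • 1)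
    (hdesign2 : ∀ M N : Matrix (Fin d) (Fin d) ℂ,
      Matrix.trace M = 0 → Matrix.trace N = 0 →
      (G.card : ℂ)⁻¹ • ∑ g ∈ G, (g * M * gᴴ) ⊗ₖ (g * N * gᴴ) =
        (Matrix.trace (M * N) / ((d : ℂ) ^ 2 - 1)) •
          (swapOp (Fin d) - ((d : ℂ))⁻¹ • 1))
    -- the noise maps, with Λ = Λ_R ∘ Λ_L trace preserving
    (ΛL ΛR : Module.End ℂ (Matrix (Fin d) (Fin d) ℂ))
    (hΛtp : ∀ M : Matrix (Fin d) (Fin d) ℂ, Matrix.trace (ΛR (ΛL M)) = Matrix.trace M)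
    (E ρ : Matrix (Fin d) (Fin d) ℂ)
    -- the induced map Λ⊗Λ on M_{d²}(ℂ), characterized on Kronecker products
    (Λ₂ : Matrix (Fin d × Fin d) (Fin d × Fin d) ℂ →ₗ[ℂ]
      Matrix (Fin d × Fin d) (Fin d × Fin d) ℂ)
    (hΛ₂ : ∀ M N : Matrix (Fin d) (Fin d) ℂ, Λ₂ (M ⊗ₖ N) = ΛR (ΛL M) ⊗ₖ ΛR (ΛL N))
    -- the unitarity u ≠ 1
    (u : ℂ)
    (hu : u = Matrix.trace
      ((((Real.sqrt ((d : ℝ) ^ 2 - 1) : ℂ))⁻¹ • (swapOp (Fin d) - ((d : ℂ))⁻¹ • 1)) *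
        Λ₂ ((((Real.sqrt ((d : ℝ) ^ 2 - 1) : ℂ))⁻¹ • (swapOp (Fin d) - ((d : ℂ))⁻¹ • 1)))))
    (hu1 : u ≠ 1) :
    ∃ a b : ℂ, ∀ m : ℕ,
      ((G.card : ℂ) ^ (m + 1))⁻¹ *
        ∑ g : Fin (m + 1) → {g // g ∈ G},
          (Matrix.trace (E *
            ((List.ofFn fun i : Fin (m + 1) =>
              ΛL * adMap (g i : Matrix (Fin d) (Fin d) ℂ) * ΛR).reverse.prod ρ))) ^ 2
      = a + b * u ^ m := by
  classical
  have hG : (G.card : ℂ) ≠ 0 := by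
    exact_mod_cast (Finset.card_pos.mpr ⟨1, hGone⟩).ne'
  have hd0 : (d : ℂ) ≠ 0 := by
    have : d ≠ 0 := by omega
    exact_mod_cast this
  have hpos : (0 : ℝ) ≤ (d : ℝ) ^ 2 - 1 := by
    have : (2 : ℝ) ≤ d := by exact_mod_cast hd
    nlinarith
  have htw := twirl d hd G hGunitary hG hdesign1 hdesign2
  set K := swapOp (Fin d) - ((d : ℂ))⁻¹ • (1 : Matrix (Fin d × Fin d) (Fin d × Fin d) ℂ) with hK
  have hsq : ((Real.sqrt ((d : ℝ) ^ 2 - 1) : ℂ))⁻¹ * ((Real.sqrt ((d : ℝ) ^ 2 - 1) : ℂ))⁻¹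
      = ((d : ℂ) ^ 2 - 1)⁻¹ := by
    rw [← mul_inv, ← Complex.ofReal_mul, Real.mul_self_sqrt hpos]
    push_cast
    rfl
  have hu' : ((d : ℂ) ^ 2 - 1)⁻¹ * Matrix.trace (K * Λ₂ K) = u := by
    rw [hu, map_smul, Matrix.smul_mul, Matrix.mul_smul, smul_smul, hsq, Matrix.trace_smul,
      smul_eq_mul]
  have hΛcomp : ∀ Z, tensMap ΛR (tensMap ΛL Z) = Λ₂ Z := by
    intro Z
    have : tensMap ΛR ∘ₗ tensMap ΛL = Λ₂ := by
      apply kron_ext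
      intro M N
      rw [LinearMap.comp_apply, tensMap_kron, tensMap_kron, hΛ₂]
    exact LinearMap.congr_fun this Z
  have htrace : ∀ Z, Matrix.trace (Λ₂ Z) = Matrix.trace Z := by
    intro Z
    have : Matrix.traceLinearMap (Fin d × Fin d) ℂ ℂ ∘ₗ Λ₂ =
        Matrix.traceLinearMap (Fin d × Fin d) ℂ ℂ := by
      apply kron_ext
      intro M N
      simp only [LinearMap.comp_apply, Matrix.traceLinearMap_apply]
      rw [hΛ₂, trace_kronecker, trace_kronecker, hΛtp, hΛtp]
    exact LinearMap.congr_fun this Z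
  have htK : Matrix.trace K = 0 := by
    rw [hK, Matrix.trace_sub, trace_swap, Matrix.trace_smul, Matrix.trace_one]
    simp
    field_simp
    simp
  let S : ℕ → Matrix (Fin d × Fin d) (Fin d × Fin d) ℂ := fun m =>
    ∑ g : Fin m → {g // g ∈ G},
      (((List.ofFn fun i : Fin m =>
        ΛL * adMap (g i : Matrix (Fin d) (Fin d) ℂ) * ΛR).reverse.prod ρ) ⊗ₖ
       ((List.ofFn fun i : Fin m =>
        ΛL * adMap (g i : Matrix (Fin d) (Fin d) ℂ) * ΛR).reverse.prod ρ))
  have hrec : ∀ m, ((G.card : ℂ) ^ (m + 1))⁻¹ • S (m + 1) =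
      tensMap ΛL ((((d : ℂ) ^ 2)⁻¹ *
          Matrix.trace (tensMap ΛR (((G.card : ℂ) ^ m)⁻¹ • S m))) • 1 +
        (((d : ℂ) ^ 2 - 1)⁻¹ *
          Matrix.trace (K * tensMap ΛR (((G.card : ℂ) ^ m)⁻¹ • S m))) • K) := by
    intro m
    rw [← htw, seq_sum G ΛL ΛR ρ S (fun _ => rfl) m, pow_succ, mul_inv, mul_smul, ← map_smul]
    simp only [map_smul, ← Finset.smul_sum]
    rw [smul_comm]
  obtain ⟨x, hx⟩ : ∃ x, x = ((d : ℂ) ^ 2)⁻¹ *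
          Matrix.trace (tensMap ΛR (((G.card : ℂ) ^ 0)⁻¹ • S 0)) := ⟨_, rfl⟩
  obtain ⟨y, hy⟩ : ∃ y, y = ((d : ℂ) ^ 2 - 1)⁻¹ *
          Matrix.trace (K * tensMap ΛR (((G.card : ℂ) ^ 0)⁻¹ • S 0)) := ⟨_, rfl⟩
  obtain ⟨t, ht⟩ : ∃ t, t = ((d : ℂ) ^ 2 - 1)⁻¹ * Matrix.trace (K * Λ₂ 1) := ⟨_, rfl⟩
  have h1u : 1 - u ≠ 0 := sub_ne_zero.mpr hu1.symm
  have hform : ∀ m, ((G.card : ℂ) ^ (m + 1))⁻¹ • S (m + 1) =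
      tensMap ΛL (x • 1 + (t * x / (1 - u) + (y - t * x / (1 - u)) * u ^ m) • K) := by
    intro m
    induction m with
    | zero =>
      rw [hrec, ← hx, ← hy]
      simp
    | succ m ih =>
      rw [hrec, ih, hΛcomp, htrace]
      have e1 : ∀ z : ℂ, ((d : ℂ) ^ 2)⁻¹ * Matrix.trace
          (x • (1 : Matrix (Fin d × Fin d) (Fin d × Fin d) ℂ) + z • K) = x := by
        intro z
        rw [Matrix.trace_add, Matrix.trace_smul, Matrix.trace_smul, htK, Matrix.trace_one]
        simp
        field_simp
      have e2 : ∀ z : ℂ, ((d : ℂ) ^ 2 - 1)⁻¹ * Matrix.trace (K * Λ₂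
          (x • (1 : Matrix (Fin d × Fin d) (Fin d × Fin d) ℂ) + z • K)) = x * t + z * u := by
        intro z
        rw [map_add, map_smul, map_smul, Matrix.mul_add, Matrix.mul_smul, Matrix.mul_smul,
          Matrix.trace_add, Matrix.trace_smul, Matrix.trace_smul, smul_eq_mul, smul_eq_mul,
          ← hu', ht]
        ring
      rw [e1, e2]
      congr 3
      field_simp
      ring
  have hL : ∀ m, ((G.card : ℂ) ^ (m + 1))⁻¹ *
        ∑ g : Fin (m + 1) → {g // g ∈ G},
          (Matrix.trace (E *
            ((List.ofFn fun i : Fin (m + 1) =>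
              ΛL * adMap (g i : Matrix (Fin d) (Fin d) ℂ) * ΛR).reverse.prod ρ))) ^ 2
      = Matrix.trace ((E ⊗ₖ E) * (((G.card : ℂ) ^ (m + 1))⁻¹ • S (m + 1))) := by
    intro m
    rw [Matrix.mul_smul, Matrix.trace_smul, smul_eq_mul]
    congr 1
    simp only [S]
    rw [Finset.mul_sum, Matrix.trace_sum]
    refine Finset.sum_congr rfl fun g _ => ?_
    rw [← mul_kronecker_mul, trace_kronecker, sq]
  refine ⟨x * Matrix.trace ((E ⊗ₖ E) * tensMap ΛL 1) +
      t * x / (1 - u) * Matrix.trace ((E ⊗ₖ E) * tensMap ΛL K),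
    (y - t * x / (1 - u)) * Matrix.trace ((E ⊗ₖ E) * tensMap ΛL K), fun m => ?_⟩
  rw [hL, hform, map_add, map_smul, map_smul, Matrix.mul_add, Matrix.mul_smul, Matrix.mul_smul,
    Matrix.trace_add, Matrix.trace_smul, Matrix.trace_smul, smul_eq_mul, smul_eq_mul]
  ring

end
end
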